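/- arXiv:1207.5302 — 6 statements merged into one kernel-verified Lean document; each statement's English description precedes it below -/
import Mathlib

section
/- Let U, ψ, φ : ℝ → ℝ and E, Ẽ ∈ ℝ, and suppose that on an open interval I the functions ψ and φ are twice differentiable, φ is nonvanishing, and the Schrödinger equations -ψ''(x) + U(x)ψ(x) = Eψ(x) and -φ''(x) + U(x)φ(x) = Ẽφ(x) hold for all x ∈ I. Then the function ψ⁽¹⁾(x) := (φ(x)ψ'(x) - φ'(x)ψ(x))/φ(x) satisfies -ψ⁽¹⁾''(x) + U⁽¹⁾(x)ψ⁽¹⁾(x) = Eψ⁽¹⁾(x) for all x ∈ I, where U⁽¹⁾(x) := U(x) - 2·(d²/dx²) log|φ(x)| = U(x) - 2(φ''(x)/φ(x) - (φ'(x)/φ(x))²). -/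
/-- The Wronskian of solutions of two Schrödinger equations with the same potential has derivative
the difference of the energies times the product of the solutions. -/
theorem hasDerivAt_wronskian_of_schrodinger {ψ φ : ℝ → ℝ} {u E Et x : ℝ}
    (hψ : DifferentiableAt ℝ ψ x) (hψ' : DifferentiableAt ℝ (deriv ψ) x)
    (hφ : DifferentiableAt ℝ φ x) (hφ' : DifferentiableAt ℝ (deriv φ) x)
    (hSψ : -deriv (deriv ψ) x + u * ψ x = E * ψ x)
    (hSφ : -deriv (deriv φ) x + u * φ x = Et * φ x) :
    HasDerivAt (fun y => φ y * deriv ψ y - deriv φ y * ψ y) ((Et - E) * (φ x * ψ x)) x := by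
  refine ((hφ.hasDerivAt.fun_mul hψ'.hasDerivAt).fun_sub
    (hφ'.hasDerivAt.fun_mul hψ.hasDerivAt)).congr_deriv ?_
  linear_combination ψ x * hSφ - φ x * hSψ

/-- A single Darboux transformation maps solutions of the
Schrödinger equation with potential `U` to solutions with the deformed
potential `U⁽¹⁾ = U - 2 (log |φ|)'' = U - 2 (φ''/φ - (φ'/φ)²)`. -/
theorem darboux_transformation
    (U ψ φ : ℝ → ℝ) (E Et : ℝ) (a b : ℝ)
    (I : Set ℝ) (hI : I = Set.Ioo a b)
    (hψ : ∀ x ∈ I, DifferentiableAt ℝ ψ x)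
    (hψ' : ∀ x ∈ I, DifferentiableAt ℝ (deriv ψ) x)
    (hφ : ∀ x ∈ I, DifferentiableAt ℝ φ x)
    (hφ' : ∀ x ∈ I, DifferentiableAt ℝ (deriv φ) x)
    (hφ0 : ∀ x ∈ I, φ x ≠ 0)
    (hSψ : ∀ x ∈ I, -deriv (deriv ψ) x + U x * ψ x = E * ψ x)
    (hSφ : ∀ x ∈ I, -deriv (deriv φ) x + U x * φ x = Et * φ x) :
    ∀ x ∈ I,
      -deriv (deriv (fun y => (φ y * deriv ψ y - deriv φ y * ψ y) / φ y)) x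
        + (U x - 2 * (deriv (deriv φ) x / φ x - (deriv φ x / φ x) ^ 2))
            * ((φ x * deriv ψ x - deriv φ x * ψ x) / φ x)
      = E * ((φ x * deriv ψ x - deriv φ x * ψ x) / φ x) := by
  have hW : ∀ y ∈ I, HasDerivAt (fun y => φ y * deriv ψ y - deriv φ y * ψ y)
      ((Et - E) * (φ y * ψ y)) y := fun y hy =>
    hasDerivAt_wronskian_of_schrodinger (hψ y hy) (hψ' y hy) (hφ y hy) (hφ' y hy)
      (hSψ y hy) (hSφ y hy)
  intro x hx
  have hI_nhds : I ∈ nhds x := (hI ▸ isOpen_Ioo : IsOpen I).mem_nhds hx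
  have hderiv : deriv (fun y => (φ y * deriv ψ y - deriv φ y * ψ y) / φ y) =ᶠ[nhds x]
      fun y => (Et - E) * ψ y
        - (φ y * deriv ψ y - deriv φ y * ψ y) * deriv φ y / φ y ^ 2 := by
    filter_upwards [hI_nhds] with y hy
    have hy0 := hφ0 y hy
    rw [((hW y hy).fun_div (hφ y hy).hasDerivAt hy0).deriv]
    field_simp
  have hx0 := hφ0 x hx
  have hsecond := ((hψ x hx).hasDerivAt.const_mul (Et - E)).fun_sub
    (((hW x hx).fun_mul (hφ' x hx).hasDerivAt).fun_div
      ((hφ x hx).hasDerivAt.fun_pow 2) (pow_ne_zero 2 hx0))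
  rw [hderiv.deriv_eq, hsecond.deriv]
  have hφ'' : deriv (deriv φ) x = (U x - Et) * φ x := by linear_combination -hSφ x hx
  rw [hφ'']
  field_simp
  ring
end

section
/- For every x > 0, W[φ̃₁^III(·;3/4), φ̃₂^I(·;3/4)](x) = (5/256) e^{x²} (3 + 4x²)³; in particular this Wronskian has a zero of order exactly 3 (as a polynomial in η = x²) at η = −3/4. -/
/-- The degree-`v` generalized Laguerre polynomial `L_v^{(α)}(y)` for `v ∈ {1,2,3}`. -/
noncomputable def Lv (v : ℕ) (α y : ℝ) : ℝ :=
  if v = 1 then α + 1 - y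
  else if v = 2 then ((α+1)*(α+2) - 2*(α+2)*y + y^2)/2
  else ((α+1)*(α+2)*(α+3) - 3*(α+2)*(α+3)*y + 3*(α+3)*y^2 - y^3)/6

/-- Type I seed function `φ̃_v^I(x;g) = e^{x²/2} x^g L_v^{(g-1/2)}(-x²)`. -/
noncomputable def seedI (v : ℕ) (g x : ℝ) : ℝ :=
  Real.exp (x^2/2) * x ^ g * Lv v (g - 1/2) (-x^2)

/-- Type II seed function `φ̃_v^II(x;g) = e^{-x²/2} x^{1-g} L_v^{(1/2-g)}(x²)`. -/
noncomputable def seedII (v : ℕ) (g x : ℝ) : ℝ :=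
  Real.exp (-x^2/2) * x ^ (1-g) * Lv v (1/2 - g) (x^2)

/-- Type III seed function `φ̃_v^III(x;g) = e^{x²/2} x^{1-g} L_v^{(1/2-g)}(-x²)`. -/
noncomputable def seedIII (v : ℕ) (g x : ℝ) : ℝ :=
  Real.exp (x^2/2) * x ^ (1-g) * Lv v (1/2 - g) (-x^2)

/-- The Wronskian `W[f,g](x) = f(x)g'(x) - f'(x)g(x)`. -/
noncomputable def Wr (f g : ℝ → ℝ) (x : ℝ) : ℝ :=
  f x * deriv g x - deriv f x * g x

/-- Derivative of a function of the form `e^{x²/2} x^a p(x)` at a positive point. -/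
theorem hasDerivAt_exp_mul_rpow_mul {a x p' : ℝ} {p : ℝ → ℝ} (hx : 0 < x)
    (hp : HasDerivAt p p' x) :
    HasDerivAt (fun y => Real.exp (y^2/2) * y ^ a * p y)
      (Real.exp (x^2/2) * x ^ a * ((x + a / x) * p x + p')) x := by
  have hexp : HasDerivAt (fun y : ℝ => Real.exp (y^2/2)) (Real.exp (x^2/2) * x) x := by
    refine ((hasDerivAt_pow 2 x).div_const 2).exp.congr_deriv ?_
    norm_num
  refine ((hexp.mul (Real.hasDerivAt_rpow_const (p := a) (Or.inl hx.ne'))).mul hp).congr_deriv ?_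
  simp only [Real.rpow_sub_one hx.ne', Pi.mul_apply]
  ring

/-- The Wronskian of `e^{x²/2} x^a p(x)` and `e^{x²/2} x^b q(x)` at a positive point. -/
theorem Wr_exp_mul_rpow_mul {a b x p' q' : ℝ} {p q : ℝ → ℝ} (hx : 0 < x)
    (hp : HasDerivAt p p' x) (hq : HasDerivAt q q' x) :
    Wr (fun y => Real.exp (y^2/2) * y ^ a * p y) (fun y => Real.exp (y^2/2) * y ^ b * q y) x =
      Real.exp (x^2) * x ^ (a + b) * ((b - a) / x * (p x * q x) + (p x * q' - p' * q x)) := by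
  have hsq : Real.exp (x^2) = Real.exp (x^2/2) * Real.exp (x^2/2) := by
    rw [← Real.exp_add, add_halves]
  rw [Wr, (hasDerivAt_exp_mul_rpow_mul hx hp).deriv, (hasDerivAt_exp_mul_rpow_mul hx hq).deriv,
    Real.rpow_add hx, hsq]
  ring

theorem hasDerivAt_Lv_one_neg_sq (α x : ℝ) :
    HasDerivAt (fun y => Lv 1 α (-y^2)) (2 * x) x := by
  simp only [Lv, ↓reduceIte]
  refine ((hasDerivAt_pow 2 x).neg.const_sub (α + 1)).congr_deriv ?_
  norm_num

theorem hasDerivAt_Lv_two_neg_sq (α x : ℝ) :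
    HasDerivAt (fun y => Lv 2 α (-y^2)) (2 * x * (α + 2 + x^2)) x := by
  have h := (hasDerivAt_pow 2 x).neg
  simp only [Lv, OfNat.ofNat_ne_one, ↓reduceIte]
  refine ((((h.const_mul (2*(α+2))).const_sub ((α+1)*(α+2))).add (h.pow 2)).div_const
    2).congr_deriv ?_
  simp only [Pi.neg_apply]
  norm_num
  ring

/-- at `g = 3/4` the Wronskian `W[φ̃₁^III, φ̃₂^I]` develops a cubic zero:
it equals `(5/256) e^{x²}(3+4x²)³`, and the corresponding cubic polynomial in `η = x²`
has a root of multiplicity exactly `3` at `η = −3/4`. -/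
theorem wronskian_A_cubic_zero :
    (∀ x : ℝ, 0 < x →
      Wr (seedIII 1 (3/4)) (seedI 2 (3/4)) x = (5/256) * Real.exp (x^2) * (3 + 4*x^2)^3) ∧
    Polynomial.rootMultiplicity (-3/4 : ℝ)
        (Polynomial.C (27/8 : ℝ) + Polynomial.C (27/2) * Polynomial.X
          + Polynomial.C 18 * Polynomial.X^2 + Polynomial.C 8 * Polynomial.X^3) = 3 := by
  constructor
  · intro x hx
    have h := Wr_exp_mul_rpow_mul (a := 1 - 3/4) (b := 3/4) hx
      (hasDerivAt_Lv_one_neg_sq (1/2 - 3/4) x) (hasDerivAt_Lv_two_neg_sq (3/4 - 1/2) x)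
    refine h.trans ?_
    rw [sub_add_cancel, Real.rpow_one]
    simp only [Lv, OfNat.ofNat_ne_one, ↓reduceIte]
    field_simp
    ring
  · have hfac : (Polynomial.C (27/8 : ℝ) + Polynomial.C (27/2) * Polynomial.X
          + Polynomial.C 18 * Polynomial.X^2 + Polynomial.C 8 * Polynomial.X^3) =
        Polynomial.C 8 * (Polynomial.X - Polynomial.C (-3/4)) ^ 3 := by
      refine Polynomial.funext fun y => ?_
      simp only [Polynomial.eval_add, Polynomial.eval_mul, Polynomial.eval_C, Polynomial.eval_X,
        Polynomial.eval_pow, Polynomial.eval_sub]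
      ring
    have hne : (Polynomial.C (8 : ℝ)) * (Polynomial.X - Polynomial.C (-3/4)) ^ 3 ≠ 0 :=
      mul_ne_zero (Polynomial.C_ne_zero.mpr (by norm_num))
        (pow_ne_zero _ (Polynomial.X_sub_C_ne_zero _))
    rw [hfac, Polynomial.rootMultiplicity_mul hne, Polynomial.rootMultiplicity_C,
      Polynomial.rootMultiplicity_X_sub_C_pow, zero_add]
end

section
/- For every natural number n ≥ 0, the polynomial 𝓛ᴬ_n(η) := (−117 + 156η + 208η² + 64η³ − 4n(3+4η)²) L_n^{(1/4)}(η) − 4η(3+4η)(15+4η) (d/dη)L_n^{(1/4)}(η) has degree n+3 and satisfies, for all real η, the differential equation 4η(3+4η) 𝓛ᴬ_n''(η) − (4η−1)(15+4η) 𝓛ᴬ_n'(η) + 4(5 + 12η + n(3+4η)) 𝓛ᴬ_n(η) = 0. Moreover the polynomial 𝓛ᴬ_{−2}(η) := 15 + 4η satisfies the same equation with n replaced by −2, i.e. 4η(3+4η)·0 − (4η−1)(15+4η)·4 + 4(5 + 12η − 2(3+4η))(15+4η) = 0. -/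
/-- The generalized Laguerre polynomial
`L_n^{(α)}(y) = Σ_{k=0}^{n} ((−1)^k/(k!(n−k)!)) (Π_{j=k+1}^{n} (α+j)) y^k`. -/
noncomputable def genLag (n : ℕ) (α : ℝ) (y : ℝ) : ℝ :=
  ∑ k ∈ Finset.range (n+1),
    ((-1:ℝ)^k / ((Nat.factorial k : ℝ) * (Nat.factorial (n-k) : ℝ)))
      * (∏ j ∈ Finset.Icc (k+1) n, (α + (j:ℝ))) * y^k

/-- The polynomial `𝓛ᴬ_n(η)` of case (A). -/
noncomputable def LA (n : ℕ) (η : ℝ) : ℝ :=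
  (-117 + 156*η + 208*η^2 + 64*η^3 - 4*(n:ℝ)*(3+4*η)^2) * genLag n (1/4) η
    - 4*η*(3+4*η)*(15+4*η) * deriv (genLag n (1/4)) η

open Polynomial in
/-- The generalized Laguerre polynomial `L_n^{(α)}` as an element of `ℝ[X]`. -/
noncomputable def genLagPoly (n : ℕ) (α : ℝ) : ℝ[X] :=
  ∑ k ∈ Finset.range (n + 1),
    C (((-1 : ℝ) ^ k / ((Nat.factorial k : ℝ) * (Nat.factorial (n - k) : ℝ)))
      * ∏ j ∈ Finset.Icc (k + 1) n, (α + (j : ℝ))) * X ^ k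

open Polynomial in
/-- The polynomial `𝓛ᴬ_n` of case (A) as an element of `ℝ[X]`. -/
noncomputable def LAPoly (n : ℕ) : ℝ[X] :=
  (64 * X ^ 3 + 208 * X ^ 2 + 156 * X - 117 - 4 * (n : ℝ[X]) * (3 + 4 * X) ^ 2)
      * genLagPoly n (1 / 4)
    - 4 * X * (3 + 4 * X) * (15 + 4 * X) * derivative (genLagPoly n (1 / 4))

section

open Polynomial

theorem genLagPoly_eval (n : ℕ) (α y : ℝ) : (genLagPoly n α).eval y = genLag n α y := by
  simp only [genLagPoly, genLag, eval_finsetSum, eval_mul, eval_C, eval_pow, eval_X]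

theorem LAPoly_eval (n : ℕ) (y : ℝ) : (LAPoly n).eval y = LA n y := by
  have h : genLag n (1 / 4) = fun y => (genLagPoly n (1 / 4)).eval y :=
    funext fun y => (genLagPoly_eval n _ y).symm
  simp only [LA, h, Polynomial.deriv, LAPoly, eval_sub, eval_mul, eval_add, eval_pow, eval_X,
    eval_natCast, eval_ofNat]
  ring

theorem genLagPoly_coeff (n : ℕ) (α : ℝ) (k : ℕ) :
    (genLagPoly n α).coeff k = if k ≤ n then
      ((-1 : ℝ) ^ k / ((Nat.factorial k : ℝ) * (Nat.factorial (n - k) : ℝ)))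
        * ∏ j ∈ Finset.Icc (k + 1) n, (α + (j : ℝ)) else 0 := by
  simp only [genLagPoly, finsetSum_coeff, coeff_C_mul, coeff_X_pow, mul_ite, mul_one, mul_zero,
    Finset.sum_ite_eq, Finset.mem_range, Nat.lt_succ_iff]

theorem genLagPoly_coeff_succ (n : ℕ) (α : ℝ) (k : ℕ) :
    ((k : ℝ) + 1) * (α + 1 + k) * (genLagPoly n α).coeff (k + 1)
      = ((k : ℝ) - n) * (genLagPoly n α).coeff k := by
  simp only [genLagPoly_coeff]
  rcases lt_trichotomy k n with h | rfl | h
  · obtain ⟨m, rfl⟩ := Nat.exists_eq_add_of_lt h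
    rw [if_pos (by omega), if_pos (by omega), show k + m + 1 - (k + 1) = m by omega,
      show k + m + 1 - k = m + 1 by omega,
      ← Finset.mul_prod_Ioc_eq_prod_Icc (show k + 1 ≤ k + m + 1 by omega),
      ← Finset.Icc_succ_left_eq_Ioc, Nat.factorial_succ, Nat.factorial_succ]
    simp only [Order.succ_eq_add_one]
    push_cast
    have := Nat.factorial_ne_zero k
    have := Nat.factorial_ne_zero m
    field_simp
    ring
  · simp
  · rw [if_neg (by omega), if_neg (by omega)]
    simp

theorem genLagPoly_natDegree_le (n : ℕ) (α : ℝ) : (genLagPoly n α).natDegree ≤ n :=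
  natDegree_le_iff_coeff_eq_zero.2 fun k hk => by
    rw [genLagPoly_coeff, if_neg (by omega)]

theorem genLagPoly_coeff_self_ne_zero (n : ℕ) (α : ℝ) : (genLagPoly n α).coeff n ≠ 0 := by
  simp [genLagPoly_coeff, Nat.factorial_ne_zero]

theorem genLagPoly_natDegree (n : ℕ) (α : ℝ) : (genLagPoly n α).natDegree = n :=
  natDegree_eq_of_le_of_coeff_ne_zero (genLagPoly_natDegree_le n α)
    (genLagPoly_coeff_self_ne_zero n α)

/-- Laguerre's differential equation. -/
theorem genLagPoly_ode (n : ℕ) (α : ℝ) :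
    X * derivative (derivative (genLagPoly n α))
      + (C (α + 1) - X) * derivative (genLagPoly n α) + C (n : ℝ) * genLagPoly n α = 0 := by
  ext k
  have h := genLagPoly_coeff_succ n α k
  rcases k with _ | k
  · simp only [sub_mul, coeff_add, coeff_sub, coeff_C_mul, coeff_X_mul_zero, coeff_derivative,
      coeff_zero]
    push_cast at h ⊢
    linear_combination h
  · simp only [sub_mul, coeff_add, coeff_sub, coeff_C_mul, coeff_X_mul, coeff_derivative,
      coeff_zero]
    push_cast at h ⊢
    linear_combination h

theorem LAPoly_natDegree (n : ℕ) : (LAPoly n).natDegree = n + 3 := by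
  have hq := genLagPoly_natDegree n (1 / 4)
  have hq0 : genLagPoly n (1 / 4) ≠ 0 := fun h =>
    genLagPoly_coeff_self_ne_zero n (1 / 4) (by rw [h, coeff_zero])
  set q := genLagPoly n (1 / 4) with hqdef
  have hA : (64 * X ^ 3 + 208 * X ^ 2 + 156 * X - 117
      - 4 * (n : ℝ[X]) * (3 + 4 * X) ^ 2).natDegree = 3 := by
    compute_degree!
  have hB : (4 * X * (3 + 4 * X) * (15 + 4 * X) : ℝ[X]).natDegree = 3 := by
    compute_degree!
  have hA0 : (64 * X ^ 3 + 208 * X ^ 2 + 156 * X - 117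
      - 4 * (n : ℝ[X]) * (3 + 4 * X) ^ 2) ≠ 0 := ne_zero_of_natDegree_gt (n := 2) (by omega)
  have hAq := natDegree_mul hA0 hq0
  rw [hA, hq] at hAq
  rw [LAPoly, ← hqdef, natDegree_sub_eq_left_of_natDegree_lt, hAq, add_comm]
  rw [hAq]
  rcases Nat.eq_zero_or_pos n with h | h
  · have : derivative q = 0 := derivative_of_natDegree_zero (by omega)
    simp [this]
  · have := natDegree_derivative_lt (p := q) (by omega)
    have := natDegree_mul_le (p := (4 * X * (3 + 4 * X) * (15 + 4 * X) : ℝ[X]))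
      (q := derivative q)
    omega

theorem LAPoly_ode (n : ℕ) :
    4 * X * (3 + 4 * X) * derivative (derivative (LAPoly n))
      - (4 * X - 1) * (15 + 4 * X) * derivative (LAPoly n)
      + 4 * (5 + 12 * X + (n : ℝ[X]) * (3 + 4 * X)) * LAPoly n = 0 := by
  have h := genLagPoly_ode n (1 / 4)
  have h' := congrArg derivative h
  have hC : (4 : ℝ[X]) * C (1 / 4 + 1) = 5 := by
    rw [← C_ofNat, ← C_mul, ← C_ofNat]
    norm_num
  simp only [LAPoly, derivative_mul, derivative_add, derivative_sub, derivative_X,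
    derivative_C, derivative_natCast, derivative_ofNat, derivative_zero,
    derivative_pow, derivative_one, map_natCast] at h h' ⊢
  generalize derivative (derivative (derivative (genLagPoly n (1 / 4)))) = q3 at *
  generalize derivative (derivative (genLagPoly n (1 / 4))) = q2 at *
  generalize derivative (genLagPoly n (1 / 4)) = q1 at *
  generalize genLagPoly n (1 / 4) = q0 at *
  generalize C (1 / 4 + 1 : ℝ) = c at *
  push_cast
  have e : 4 * X * q2 + (5 - 4 * X) * q1 + 4 * (n : ℝ[X]) * q0 = 0 := by
    linear_combination 4 * h - q1 * hC
  have e' : 4 * X * q3 + (9 - 4 * X) * q2 + (4 * (n : ℝ[X]) - 4) * q1 = 0 := by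
    linear_combination 4 * h' - q2 * hC
  linear_combination
    ((3 + 4 * X) * ((64 * X ^ 3 + 208 * X ^ 2 + 156 * X - 117
          - 4 * (n : ℝ[X]) * (3 + 4 * X) ^ 2) - 2 * (180 + 576 * X + 192 * X ^ 2))
      + (3 + 4 * X) * (15 + 4 * X) ^ 2 * (4 * X - 1)
      + (3 + 4 * X) ^ 2 * (15 + 4 * X) * (9 - 4 * X)) * e
    - 4 * X * (3 + 4 * X) ^ 2 * (15 + 4 * X) * e'

end

/-- `𝓛ᴬ_n` has degree `n+3` and satisfies the second-order differential
equation of case (A); the extra member `𝓛ᴬ_{−2}(η) = 15+4η` satisfies the same equation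
with `n` replaced by `−2`. -/
theorem LA_degree_and_ode (n : ℕ) :
    (∃ p : Polynomial ℝ, p.natDegree = n + 3 ∧ ∀ η : ℝ, p.eval η = LA n η) ∧
    (∀ η : ℝ,
      4*η*(3+4*η) * deriv (deriv (LA n)) η - (4*η-1)*(15+4*η) * deriv (LA n) η
        + 4*(5 + 12*η + (n:ℝ)*(3+4*η)) * LA n η = 0) ∧
    (∀ η : ℝ,
      4*η*(3+4*η) * 0 - (4*η-1)*(15+4*η) * 4
        + 4*(5 + 12*η + (-2)*(3+4*η)) * (15+4*η) = 0) := by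
  refine ⟨⟨LAPoly n, LAPoly_natDegree n, LAPoly_eval n⟩, fun η => ?_, fun η => by ring⟩
  have h := congrArg (Polynomial.eval η) (LAPoly_ode n)
  have hLA : LA n = fun y => (LAPoly n).eval y := funext fun y => (LAPoly_eval n y).symm
  have hd : deriv (LA n) = fun y => (LAPoly n).derivative.eval y := by
    rw [hLA]
    exact funext fun y => Polynomial.deriv _
  rw [hd, Polynomial.deriv, hLA]
  simpa using h
end

section
/- For every natural number n ≥ 0, the polynomial 𝓛ᴰ_n(η) := ((3+4η)(63+16η²) − 16nη(−3+4η)²) L_n^{(7/4)}(η) − 36η(−3+4η)(1+4η) (d/dη)L_n^{(7/4)}(η) has degree n+3 and satisfies, for all real η, the differential equation 4η(−3+4η) 𝓛ᴰ_n''(η) − (1+4η)(9+4η) 𝓛ᴰ_n'(η) + 4(3 + 12η + n(−3+4η)) 𝓛ᴰ_n(η) = 0. Moreover the polynomial 𝓛ᴰ_{−2}(η) := 1 + 4η satisfies the same equation with n replaced by −2. -/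
/-- The polynomial `𝓛ᴰ_n(η)` of case (D). -/
noncomputable def LD (n : ℕ) (η : ℝ) : ℝ :=
  ((3+4*η)*(63+16*η^2) - 16*(n:ℝ)*η*(-3+4*η)^2) * genLag n (7/4) η
    - 36*η*(-3+4*η)*(1+4*η) * deriv (genLag n (7/4)) η

open Polynomial in
/-- The generalized Laguerre polynomial as an element of `ℝ[X]`. -/
noncomputable def laguerrePoly (n : ℕ) (α : ℝ) : Polynomial ℝ :=
  ∑ k ∈ Finset.range (n + 1),
    monomial k (((-1 : ℝ) ^ k / ((Nat.factorial k : ℝ) * (Nat.factorial (n - k) : ℝ)))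
      * ∏ j ∈ Finset.Icc (k + 1) n, (α + (j : ℝ)))

namespace laguerrePoly

open Polynomial

theorem genLag_eq_eval (n : ℕ) (α : ℝ) :
    genLag n α = fun y => (laguerrePoly n α).eval y := by
  ext y
  simp [genLag, laguerrePoly, eval_finsetSum, eval_monomial]

theorem coeff_eq (n : ℕ) (α : ℝ) (k : ℕ) :
    (laguerrePoly n α).coeff k = if k ≤ n then
      ((-1 : ℝ) ^ k / ((Nat.factorial k : ℝ) * (Nat.factorial (n - k) : ℝ)))
        * ∏ j ∈ Finset.Icc (k + 1) n, (α + (j : ℝ)) else 0 := by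
  simp [laguerrePoly, coeff_monomial]

theorem natDegree_le (n : ℕ) (α : ℝ) : (laguerrePoly n α).natDegree ≤ n := by
  rw [natDegree_le_iff_coeff_eq_zero]
  intro k hk
  rw [coeff_eq, if_neg (by lia)]

theorem coeff_self_ne_zero (n : ℕ) (α : ℝ) : (laguerrePoly n α).coeff n ≠ 0 := by
  simp [coeff_eq, Nat.factorial_ne_zero]

theorem coeff_succ (n : ℕ) (α : ℝ) (k : ℕ) :
    (k + 1) * (k + 1 + α) * (laguerrePoly n α).coeff (k + 1)
      = (k - n) * (laguerrePoly n α).coeff k := by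
  rw [coeff_eq, coeff_eq]
  rcases lt_trichotomy k n with h | rfl | h
  · obtain ⟨m, rfl⟩ := Nat.exists_eq_add_of_lt h
    rw [if_pos (by lia), if_pos (by lia),
      ← Finset.mul_prod_Ioc_eq_prod_Icc (a := k + 1) (by lia),
      ← Finset.Icc_add_one_left_eq_Ioc,
      show k + m + 1 - (k + 1) = m by lia, show k + m + 1 - k = m + 1 by lia,
      Nat.factorial_succ, Nat.factorial_succ]
    push_cast
    field_simp
    ring
  · simp
  · rw [if_neg (by lia), if_neg (by lia)]
    simp

theorem ode (n : ℕ) (α : ℝ) :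
    X * derivative (derivative (laguerrePoly n α))
      + (C (α + 1) - X) * derivative (laguerrePoly n α)
      + C (n : ℝ) * laguerrePoly n α = 0 := by
  ext k
  have h := coeff_succ n α k
  cases k with
  | zero =>
    simp [sub_mul, coeff_derivative, mul_coeff_zero] at h ⊢
    linear_combination h
  | succ k =>
    simp only [sub_mul, coeff_add, coeff_sub, coeff_X_mul, coeff_C_mul, coeff_derivative,
      coeff_zero]
    push_cast at h ⊢
    linear_combination h

end laguerrePoly

open Polynomial in
/-- The polynomial `𝓛ᴰ_n` as an element of `ℝ[X]`. -/
noncomputable def LDPoly (n : ℕ) : Polynomial ℝ :=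
  ((3 + 4 * X) * (63 + 16 * X ^ 2) - 16 * C (n : ℝ) * X * (-3 + 4 * X) ^ 2)
      * laguerrePoly n (7 / 4)
    - 36 * X * (-3 + 4 * X) * (1 + 4 * X) * derivative (laguerrePoly n (7 / 4))

namespace LDPoly

open Polynomial

theorem LD_eq_eval (n : ℕ) : LD n = fun η => (LDPoly n).eval η := by
  ext η
  simp [LD, LDPoly, laguerrePoly.genLag_eq_eval, Polynomial.deriv]

theorem natDegree_eq (n : ℕ) : (LDPoly n).natDegree = n + 3 := by
  set P := laguerrePoly n (7 / 4) with hP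
  have hPn : P.natDegree = n := natDegree_eq_of_le_of_coeff_ne_zero
    (laguerrePoly.natDegree_le n _) (laguerrePoly.coeff_self_ne_zero n _)
  have hP0 : P ≠ 0 := fun h => laguerrePoly.coeff_self_ne_zero n (7 / 4) (by simp [← hP, h])
  have hn : (64 - 256 * n : ℝ) ≠ 0 := by
    rw [sub_ne_zero]
    norm_cast
    lia
  have hA : ((3 + 4 * X) * (63 + 16 * X ^ 2)
      - 16 * C (n : ℝ) * X * (-3 + 4 * X) ^ 2 : Polynomial ℝ)
      = C (64 - 256 * n : ℝ) * X ^ 3 + C (48 + 384 * n : ℝ) * X ^ 2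
        + C (252 - 144 * n : ℝ) * X + C 189 := by
    simp only [map_add, map_sub, map_mul, map_ofNat]
    ring
  have hB : (36 * X * (-3 + 4 * X) * (1 + 4 * X) : Polynomial ℝ)
      = C 576 * X ^ 3 + C (-288) * X ^ 2 + C (-108) * X + C 0 := by
    simp only [map_neg, map_ofNat, map_zero]
    ring
  have hAdeg := natDegree_cubic (b := (48 + 384 * n : ℝ)) (c := 252 - 144 * n) (d := 189) hn
  have hA0 : (C (64 - 256 * n : ℝ) * X ^ 3 + C (48 + 384 * n : ℝ) * X ^ 2
        + C (252 - 144 * n : ℝ) * X + C 189) ≠ 0 := ne_zero_of_natDegree_gt (n := 2) (by lia)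
  have hdeg := natDegree_mul hA0 hP0
  rw [hAdeg, hPn] at hdeg
  rw [LDPoly, ← hP, hA, hB]
  rcases Nat.eq_zero_or_pos n with rfl | hpos
  · rw [derivative_of_natDegree_zero hPn, mul_zero, sub_zero, hdeg, add_comm]
  · rw [natDegree_sub_eq_left_of_natDegree_lt, hdeg, add_comm]
    rw [hdeg]
    have hB3 := natDegree_mul_le_of_le (p := C (576 : ℝ) * X ^ 3 + C (-288) * X ^ 2
      + C (-108) * X + C 0) natDegree_cubic_le (natDegree_derivative_le P)
    lia

theorem ode (n : ℕ) (η : ℝ) :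
    4 * η * (-3 + 4 * η) * (derivative (derivative (LDPoly n))).eval η
      - (1 + 4 * η) * (9 + 4 * η) * (derivative (LDPoly n)).eval η
      + 4 * (3 + 12 * η + n * (-3 + 4 * η)) * (LDPoly n).eval η = 0 := by
  have h := laguerrePoly.ode n (7 / 4)
  have h₀ := congrArg (eval η) h
  have h₁ := congrArg (fun p => eval η (derivative p)) h
  simp [LDPoly, derivative_pow] at h₀ h₁ ⊢
  linear_combination (-144 * η * (4 * η - 3) ^ 2 * (1 + 4 * η)) * h₁
    + (4 * (4 * η - 3) * (((3 + 4 * η) * (63 + 16 * η ^ 2) - 16 * n * η * (-3 + 4 * η) ^ 2)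
          - 72 * (48 * η ^ 2 - 16 * η - 3))
        + 36 * (4 * η - 3) * (1 + 4 * η) ^ 2 * (9 + 4 * η)
        + 144 * (4 * η - 3) ^ 2 * (1 + 4 * η) * (15 / 4 - η)) * h₀

end LDPoly

/-- `𝓛ᴰ_n` has degree `n+3` and satisfies the second-order differential
equation of case (D); the extra member `𝓛ᴰ_{−2}(η) = 1+4η` satisfies the same equation
with `n` replaced by `−2`. -/
theorem LD_degree_and_ode (n : ℕ) :
    (∃ p : Polynomial ℝ, p.natDegree = n + 3 ∧ ∀ η : ℝ, p.eval η = LD n η) ∧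
    (∀ η : ℝ,
      4*η*(-3+4*η) * deriv (deriv (LD n)) η - (1+4*η)*(9+4*η) * deriv (LD n) η
        + 4*(3 + 12*η + (n:ℝ)*(-3+4*η)) * LD n η = 0) ∧
    (∀ η : ℝ,
      4*η*(-3+4*η) * 0 - (1+4*η)*(9+4*η) * 4
        + 4*(3 + 12*η + (-2)*(-3+4*η)) * (1+4*η) = 0) := by
  have hLD := LDPoly.LD_eq_eval n
  refine ⟨⟨LDPoly n, LDPoly.natDegree_eq n, fun η => by rw [hLD]⟩, fun η => ?_, fun η => by ring⟩
  have hderiv : deriv (LD n) = fun η => (Polynomial.derivative (LDPoly n)).eval η := by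
    ext η
    rw [hLD, Polynomial.deriv]
  rw [hderiv, Polynomial.deriv, hLD]
  exact LDPoly.ode n η
end

section
/- Define 𝓛ᴱ_n(η) := (−24(840 + 280η + 30η² + η³) − 4n(6+η)²(14+η)) L_n^{(7)}(η) − 16η(6+η)(12+η) (d/dη)L_n^{(7)}(η) for natural n ≥ 0. Then for all natural numbers n, m ≥ 0, ∫₀^∞ e^{−η} η⁷ (6+η)^{−4} (14+η)^{−2} 𝓛ᴱ_n(η) 𝓛ᴱ_m(η) dη = δ_{nm} · 16(n+10)(n+6)(n+1)(n+2)(n+3)(n+4)(n+5)(n+6)(n+7), where δ_{nm} is the Kronecker delta and (n+1)(n+2)⋯(n+7) is the Pochhammer symbol (n+1)₇. -/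
/-- The polynomial `𝓛ᴱ_n(η)` of case (E). -/
noncomputable def LagE (n : ℕ) (η : ℝ) : ℝ :=
  (-24*(840 + 280*η + 30*η^2 + η^3) - 4*(n:ℝ)*(6+η)^2*(14+η)) * genLag n 7 η
    - 16*η*(6+η)*(12+η) * deriv (genLag n 7) η

open Polynomial MeasureTheory Filter Topology

/-- The Laguerre polynomial `L_n^{(7)}` as a formal polynomial. -/
noncomputable def lagPoly (n : ℕ) : ℝ[X] :=
  ∑ k ∈ Finset.range (n + 1),
    monomial k ((-1 : ℝ) ^ k * ((n + 7).choose (k + 7) : ℝ) / (k.factorial : ℝ))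

theorem lagPoly_coeff (n k : ℕ) :
    (lagPoly n).coeff k = (-1 : ℝ) ^ k * ((n + 7).choose (k + 7) : ℝ) / (k.factorial : ℝ) := by
  simp only [lagPoly, finsetSum_coeff, coeff_monomial, Finset.sum_ite_eq', Finset.mem_range]
  split_ifs with h
  · rfl
  · rw [Nat.choose_eq_zero_of_lt (by omega)]
    simp

theorem factorial_mul_prod_Icc (n k : ℕ) (h : k ≤ n) :
    ((k + 7).factorial : ℝ) * ∏ j ∈ Finset.Icc (k + 1) n, ((7 : ℝ) + (j : ℝ))
      = ((n + 7).factorial : ℝ) := by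
  induction n, h using Nat.le_induction with
  | base => simp
  | succ n hn ih =>
    rw [Finset.prod_Icc_succ_top (by omega), ← mul_assoc, ih,
      show n + 1 + 7 = (n + 7) + 1 by ring, Nat.factorial_succ (n + 7)]
    push_cast
    ring

theorem genLag_seven_eq (n : ℕ) : genLag n 7 = fun y => (lagPoly n).eval y := by
  funext y
  simp only [genLag, lagPoly, eval_finsetSum, eval_monomial]
  refine Finset.sum_congr rfl fun k hk => ?_
  have hkn : k ≤ n := Nat.lt_succ_iff.mp (Finset.mem_range.mp hk)
  have h1 := factorial_mul_prod_Icc n k hkn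
  rw [Nat.cast_choose ℝ (show k + 7 ≤ n + 7 by omega), show n + 7 - (k + 7) = n - k by omega, ← h1]
  have h2 : ((k + 7).factorial : ℝ) ≠ 0 := by positivity
  have h3 : (k.factorial : ℝ) ≠ 0 := by positivity
  have h4 : ((n - k).factorial : ℝ) ≠ 0 := by positivity
  field_simp

theorem deriv_genLag_seven (n : ℕ) (y : ℝ) :
    deriv (genLag n 7) y = (derivative (lagPoly n)).eval y := by
  rw [genLag_seven_eq, Polynomial.deriv]

theorem cast_choose_succ_mul (n k : ℕ) :
    ((n + 7).choose (k + 8) : ℝ) * ((k : ℝ) + 8)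
      = ((n + 7).choose (k + 7) : ℝ) * ((n : ℝ) - k) := by
  rcases le_or_gt k n with h | h
  · have := Nat.choose_succ_right_eq (n + 7) (k + 7)
    rw [show n + 7 - (k + 7) = n - k by omega] at this
    have h2 : (((n + 7).choose (k + 7 + 1) * (k + 7 + 1) : ℕ) : ℝ)
      = (((n + 7).choose (k + 7) * (n - k) : ℕ) : ℝ) := by rw [this]
    push_cast [Nat.cast_sub h] at h2
    rw [← h2]
    ring
  · rw [Nat.choose_eq_zero_of_lt (show n + 7 < k + 8 by omega),
      Nat.choose_eq_zero_of_lt (show n + 7 < k + 7 by omega)]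
    simp

theorem cast_choose_succ_succ (n k : ℕ) :
    ((n + 1 + 7).choose (k + 7) : ℝ)
      = ((n + 7).choose (k + 6) : ℝ) + ((n + 7).choose (k + 7) : ℝ) := by
  rw [show n + 1 + 7 = (n + 7) + 1 by ring, show k + 7 = (k + 6) + 1 by ring, Nat.choose_succ_succ]
  push_cast
  ring

theorem cast_choose_six_mul (n k : ℕ) :
    ((n + 7).choose (k + 7) : ℝ) * ((k : ℝ) + 7)
      = ((n + 7).choose (k + 6) : ℝ) * ((n : ℝ) + 1 - k) := by
  rcases le_or_gt k (n + 1) with h | h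
  · have := Nat.choose_succ_right_eq (n + 7) (k + 6)
    rw [show n + 7 - (k + 6) = n + 1 - k by omega] at this
    have h2 : (((n + 7).choose (k + 6 + 1) * (k + 6 + 1) : ℕ) : ℝ)
      = (((n + 7).choose (k + 6) * (n + 1 - k) : ℕ) : ℝ) := by rw [this]
    push_cast [Nat.cast_sub h] at h2
    rw [← h2]
    ring
  · rw [Nat.choose_eq_zero_of_lt (show n + 7 < k + 6 by omega),
      Nat.choose_eq_zero_of_lt (show n + 7 < k + 7 by omega)]
    simp

theorem lagPoly_ode (n : ℕ) :
    X * derivative (derivative (lagPoly n)) + (8 - X) * derivative (lagPoly n)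
      + (n : ℝ[X]) * lagPoly n = 0 := by
  ext k
  have h := cast_choose_succ_mul n k
  have hf : (k.factorial : ℝ) ≠ 0 := by positivity
  have hk : (k : ℝ) + 1 ≠ 0 := by positivity
  rw [sub_mul, ← C_ofNat, ← C_eq_natCast]
  rcases k with _ | k
  · simp only [coeff_add, coeff_sub, coeff_C_mul, coeff_X_mul_zero, coeff_derivative,
      lagPoly_coeff, coeff_zero]
    norm_num at h ⊢
    linear_combination -h
  · have h7 : k + 1 + 1 + 7 = k + 1 + 8 := by ring
    simp only [coeff_add, coeff_sub, coeff_C_mul, coeff_X_mul, coeff_derivative,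
      lagPoly_coeff, coeff_zero, Nat.factorial_succ, h7]
    rw [Nat.factorial_succ] at hf
    push_cast at h hf hk ⊢
    have hf1 : (k.factorial : ℝ) ≠ 0 := by positivity
    have hf2 : (k : ℝ) + 1 ≠ 0 := by positivity
    field_simp
    rw [pow_succ, pow_succ]
    linear_combination ((-1 : ℝ) ^ k) * h

theorem X_mul_derivative_lagPoly_succ (n : ℕ) :
    X * derivative (lagPoly (n + 1))
      = ((n : ℝ[X]) + 1) * lagPoly (n + 1) - ((n : ℝ[X]) + 8) * lagPoly n := by
  ext k
  have h := cast_choose_six_mul n k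
  have h' := cast_choose_succ_succ n k
  rw [show (n : ℝ[X]) + 1 = C ((n : ℝ) + 1) by simp, show (n : ℝ[X]) + 8 = C ((n : ℝ) + 8) by simp [← C_ofNat]]
  rcases k with _ | k
  · simp only [coeff_sub, coeff_C_mul, coeff_X_mul_zero, lagPoly_coeff]
    rw [h']
    norm_num at h ⊢
    linear_combination h
  · simp only [coeff_sub, coeff_C_mul, coeff_X_mul, coeff_derivative, lagPoly_coeff]
    rw [h']
    have hf : ((k + 1).factorial : ℝ) ≠ 0 := by positivity
    push_cast at h ⊢
    field_simp
    linear_combination h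

theorem X_mul_derivative_lagPoly (n : ℕ) :
    X * derivative (lagPoly n)
      = (X - ((n : ℝ[X]) + 8)) * lagPoly n + ((n : ℝ[X]) + 1) * lagPoly (n + 1) := by
  ext k
  have h := cast_choose_six_mul n k
  have h' := cast_choose_succ_succ n k
  rw [show (n : ℝ[X]) + 1 = C ((n : ℝ) + 1) by simp, show (n : ℝ[X]) + 8 = C ((n : ℝ) + 8) by simp [← C_ofNat],
    sub_mul]
  rcases k with _ | k
  · simp only [coeff_add, coeff_sub, coeff_C_mul, coeff_X_mul_zero, lagPoly_coeff]
    rw [h']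
    norm_num at h ⊢
    linear_combination h
  · simp only [coeff_add, coeff_sub, coeff_C_mul, coeff_X_mul, coeff_derivative, lagPoly_coeff]
    rw [h', Nat.factorial_succ]
    rw [show k + 1 + 6 = k + 7 by ring] at *
    have hf : (k.factorial : ℝ) ≠ 0 := by positivity
    have hf2 : (k : ℝ) + 1 ≠ 0 := by positivity
    push_cast at h ⊢
    field_simp
    rw [pow_succ]
    linear_combination -((-1 : ℝ) ^ k) * h

theorem lagPoly_ode_eval (n : ℕ) (x : ℝ) :
    x * (derivative (derivative (lagPoly n))).eval x + (8 - x) * (derivative (lagPoly n)).eval x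
      + n * (lagPoly n).eval x = 0 := by
  simpa using congrArg (eval x) (lagPoly_ode n)

theorem integrableOn_exp_neg_mul_eval (p : ℝ[X]) :
    IntegrableOn (fun x => Real.exp (-x) * p.eval x) (Set.Ioi 0) := by
  induction p using Polynomial.induction_on' with
  | add p q hp hq =>
    simp only [eval_add, mul_add]
    exact hp.add hq
  | monomial k a =>
    have h := (Real.GammaIntegral_convergent (s := (k : ℝ) + 1) (by positivity)).const_mul a
    refine IntegrableOn.congr_fun h (fun x _ => ?_) measurableSet_Ioi
    simp only [add_sub_cancel_right, Real.rpow_natCast, eval_monomial]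
    ring

theorem integrableOn_exp_neg_mul_eval_div (p d : ℝ[X]) (hd : ∀ x : ℝ, 0 ≤ x → 1 ≤ d.eval x) :
    IntegrableOn (fun x => Real.exp (-x) * p.eval x / d.eval x) (Set.Ioi 0) := by
  refine Integrable.mono (integrableOn_exp_neg_mul_eval p) ?_ ?_
  · refine ContinuousOn.aestronglyMeasurable (fun x hx => ?_) measurableSet_Ioi
    have := hd x (le_of_lt hx)
    exact ((by fun_prop : ContinuousAt (fun x => Real.exp (-x) * p.eval x) x).div
      d.continuous.continuousAt (by linarith)).continuousWithinAt
  · filter_upwards [ae_restrict_mem measurableSet_Ioi] with x hx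
    have := hd x (le_of_lt hx)
    rw [norm_div]
    exact div_le_self (norm_nonneg _) (this.trans (le_abs_self _))

theorem integral_deriv_exp_neg_mul_eval_div (p d : ℝ[X]) (hp : p.eval 0 = 0)
    (hd : ∀ x : ℝ, 0 ≤ x → 1 ≤ d.eval x) :
    ∫ x in Set.Ioi (0 : ℝ), Real.exp (-x) *
      ((derivative p - p) * d - p * derivative d).eval x / (d ^ 2).eval x = 0 := by
  have hd2 : ∀ x : ℝ, 0 ≤ x → 1 ≤ (d ^ 2).eval x := fun x hx => by
    rw [eval_pow]
    exact one_le_pow₀ (hd x hx)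
  have hderiv : ∀ x ∈ Set.Ici (0 : ℝ),
      HasDerivAt (fun x => Real.exp (-x) * p.eval x / d.eval x)
        (Real.exp (-x) * ((derivative p - p) * d - p * derivative d).eval x / (d ^ 2).eval x)
        x := by
    intro x hx
    have hx1 := hd x hx
    have hx0 : d.eval x ≠ 0 := by linarith
    refine (((hasDerivAt_neg x).exp.mul (p.hasDerivAt x)).div (d.hasDerivAt x) hx0).congr_deriv ?_
    simp only [eval_sub, eval_mul, eval_pow, Pi.mul_apply]
    ring
  have hlim : Tendsto (fun x => Real.exp (-x) * p.eval x / d.eval x) atTop (𝓝 0) := by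
    refine squeeze_zero_norm' ?_ (by simpa using (Polynomial.tendsto_div_exp_atTop p).norm)
    filter_upwards [eventually_ge_atTop 0] with x hx
    have := hd x hx
    rw [norm_div]
    refine (div_le_self (norm_nonneg _) (this.trans (le_abs_self _))).trans (le_of_eq ?_)
    rw [Real.exp_neg, norm_mul, norm_inv]
    simp [div_eq_inv_mul]
  have h := integral_Ioi_of_hasDerivAt_of_tendsto' hderiv
    (integrableOn_exp_neg_mul_eval_div _ _ hd2) hlim
  simpa [hp] using h

theorem integral_deriv_exp_neg_mul_eval (p : ℝ[X]) (hp : p.eval 0 = 0) :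
    ∫ x in Set.Ioi (0 : ℝ), Real.exp (-x) * (derivative p - p).eval x = 0 := by
  simpa using integral_deriv_exp_neg_mul_eval_div p 1 hp (by simp)

theorem integral_lagPoly_mul_of_ne {n m : ℕ} (h : n ≠ m) :
    ∫ x in Set.Ioi (0 : ℝ), Real.exp (-x) * (X ^ 7 * (lagPoly n * lagPoly m)).eval x = 0 := by
  have key := integral_deriv_exp_neg_mul_eval
    (X ^ 8 * (derivative (lagPoly n) * lagPoly m - lagPoly n * derivative (lagPoly m))) (by simp)
  have hc : ((m : ℝ) - n) ≠ 0 := sub_ne_zero.mpr fun e => h (Nat.cast_injective e).symm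
  refine (mul_eq_zero.mp (?_ : ((m : ℝ) - n) * _ = 0)).resolve_left hc
  rw [← integral_const_mul]
  refine Eq.trans ?_ key
  refine integral_congr_ae (ae_of_all _ fun x => ?_)
  beta_reduce
  have h1 := lagPoly_ode_eval n x
  have h2 := lagPoly_ode_eval m x
  simp only [derivative_mul, derivative_sub, derivative_X_pow, eval_mul, eval_sub, eval_add,
    eval_pow, eval_X, eval_C]
  push_cast
  linear_combination Real.exp (-x) * x ^ 7 *
    ((lagPoly n).eval x * h2 - (lagPoly m).eval x * h1)

theorem integral_lagPoly_sq_succ (n : ℕ) :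
    ((n : ℝ) + 1) * ∫ x in Set.Ioi (0 : ℝ),
        Real.exp (-x) * (X ^ 7 * (lagPoly (n + 1) * lagPoly (n + 1))).eval x
      = ((n : ℝ) + 8) * ∫ x in Set.Ioi (0 : ℝ),
        Real.exp (-x) * (X ^ 7 * (lagPoly n * lagPoly n)).eval x := by
  have key := integral_deriv_exp_neg_mul_eval (X ^ 8 * (lagPoly (n + 1) * lagPoly n)) (by simp)
  have horth := integral_lagPoly_mul_of_ne (Nat.succ_ne_self n)
  have hi := fun p q : ℝ[X] => integrableOn_exp_neg_mul_eval (X ^ 7 * (p * q))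
  have hsplit : ∀ x : ℝ, Real.exp (-x) *
      (derivative (X ^ 8 * (lagPoly (n + 1) * lagPoly n))
        - X ^ 8 * (lagPoly (n + 1) * lagPoly n)).eval x
      = (Real.exp (-x) * (X ^ 7 * (lagPoly (n + 1) * lagPoly n)).eval x
        + ((n : ℝ) + 1) * (Real.exp (-x) * (X ^ 7 * (lagPoly (n + 1) * lagPoly (n + 1))).eval x))
        - ((n : ℝ) + 8) * (Real.exp (-x) * (X ^ 7 * (lagPoly n * lagPoly n)).eval x) := by
    intro x
    have h1 := congrArg (eval x) (X_mul_derivative_lagPoly_succ n)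
    have h2 := congrArg (eval x) (X_mul_derivative_lagPoly n)
    simp only [eval_mul, eval_sub, eval_add, eval_X, eval_natCast, eval_one, eval_ofNat] at h1 h2
    simp only [derivative_mul, derivative_X_pow, eval_mul, eval_sub, eval_add,
      eval_pow, eval_X, eval_C]
    push_cast
    linear_combination Real.exp (-x) * x ^ 7 *
      ((lagPoly n).eval x * h1 + (lagPoly (n + 1)).eval x * h2)
  simp only [hsplit] at key
  rw [integral_sub, integral_add, integral_const_mul, integral_const_mul] at key
  · simp only [Nat.succ_eq_add_one] at horth
    rw [horth] at key
    linarith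
  · exact hi _ _
  · exact (hi _ _).const_mul _
  · exact (hi _ _).add ((hi _ _).const_mul _)
  · exact (hi _ _).const_mul _

theorem integral_lagPoly_sq (n : ℕ) :
    ∫ x in Set.Ioi (0 : ℝ), Real.exp (-x) * (X ^ 7 * (lagPoly n * lagPoly n)).eval x
      = ((n : ℝ) + 1) * (n + 2) * (n + 3) * (n + 4) * (n + 5) * (n + 6) * (n + 7) := by
  induction n with
  | zero =>
    have h0 : lagPoly 0 = 1 := by simp [lagPoly]
    have hG := Real.Gamma_eq_integral (s := ((7 : ℕ) : ℝ) + 1) (by positivity)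
    rw [Real.Gamma_nat_eq_factorial] at hG
    simp only [add_sub_cancel_right, Real.rpow_natCast] at hG
    simp only [h0, mul_one, eval_pow, eval_X]
    rw [← hG]
    norm_num [Nat.factorial]
  | succ n ih =>
    have h := integral_lagPoly_sq_succ n
    rw [ih] at h
    have hn : (n : ℝ) + 1 ≠ 0 := by positivity
    refine mul_left_cancel₀ hn (h.trans ?_)
    push_cast
    ring

/-- The numerator of the rational function whose multiple by `e^{-x} / ((6+x)^3 (14+x))` is the
boundary term relating `𝓛ᴱ_n 𝓛ᴱ_m` to `L_n^{(7)} L_m^{(7)}`. -/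
noncomputable def boundaryNumerator (p q : ℝ[X]) : ℝ[X] :=
  X ^ 8 * (C 384 * (X ^ 3 + C 27 * X ^ 2 + C 230 * X + C 630) * (p * q)
    + C 32 * (X ^ 4 + C 20 * X ^ 3 + C 60 * X ^ 2 - C 648 * X - C 3024)
        * (derivative p * q + p * derivative q)
    - C 64 * (X * (X + C 6) ^ 2 * (X + C 12)) * (derivative p * derivative q))

theorem weight_mul_LagE_mul_LagE (n m : ℕ) {x : ℝ} (hx : 0 < x) :
    Real.exp (-x) * x ^ 7 / ((6 + x) ^ 4 * (14 + x) ^ 2) * (LagE n x * LagE m x)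
      = 16 * ((n : ℝ) * m + 8 * n + 8 * m + 60) *
          (Real.exp (-x) * (X ^ 7 * (lagPoly n * lagPoly m)).eval x)
        + Real.exp (-x) *
          ((derivative (boundaryNumerator (lagPoly n) (lagPoly m))
              - boundaryNumerator (lagPoly n) (lagPoly m)) * ((X + C 6) ^ 3 * (X + C 14))
            - boundaryNumerator (lagPoly n) (lagPoly m)
              * derivative ((X + C 6) ^ 3 * (X + C 14))).eval x
          / (((X + C 6) ^ 3 * (X + C 14)) ^ 2 : ℝ[X]).eval x := by
  have h1 := lagPoly_ode_eval n x
  have h2 := lagPoly_ode_eval m x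
  have hx6 : x + 6 ≠ 0 := by positivity
  have hx14 : x + 14 ≠ 0 := by positivity
  simp only [LagE, deriv_genLag_seven]
  simp only [genLag_seven_eq, boundaryNumerator, derivative_mul, derivative_add,
    derivative_sub, derivative_C, derivative_X, derivative_pow, eval_mul, eval_sub, eval_add,
    eval_pow, eval_X, eval_C, eval_zero, eval_one]
  generalize eval x (derivative (derivative (lagPoly n))) = P2 at *
  generalize eval x (derivative (derivative (lagPoly m))) = Q2 at *
  generalize eval x (derivative (lagPoly n)) = P1 at *
  generalize eval x (derivative (lagPoly m)) = Q1 at *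
  generalize eval x (lagPoly n) = P at *
  generalize eval x (lagPoly m) = Q at *
  obtain rfl : P2 = (-(8 - x) * P1 - n * P) / x := by
    field_simp
    linear_combination h1
  obtain rfl : Q2 = (-(8 - x) * Q1 - m * Q) / x := by
    field_simp
    linear_combination h2
  rw [add_comm 6 x, add_comm 14 x]
  push_cast
  field_simp
  ring

/-- orthogonality of the family `{𝓛ᴱ_n}` with respect to the weight
`e^{−η} η⁷ (6+η)^{−4} (14+η)^{−2}` on `(0,∞)`, with norms `16(n+10)(n+6)(n+1)₇`. -/
theorem LagE_orthogonality (n m : ℕ) :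
    ∫ η in Set.Ioi (0:ℝ),
        Real.exp (-η) * η^7 / ((6+η)^4 * (14+η)^2) * (LagE n η * LagE m η)
      = if n = m then
          16*((n:ℝ)+10)*((n:ℝ)+6)
            *((n:ℝ)+1)*((n:ℝ)+2)*((n:ℝ)+3)*((n:ℝ)+4)*((n:ℝ)+5)*((n:ℝ)+6)*((n:ℝ)+7)
        else 0 := by
  have hd : ∀ x : ℝ, 0 ≤ x → 1 ≤ ((X + C 6) ^ 3 * (X + C 14) : ℝ[X]).eval x := by
    intro x hx
    simp only [eval_mul, eval_pow, eval_add, eval_X, eval_C]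
    exact one_le_mul_of_one_le_of_one_le (one_le_pow₀ (by linarith)) (by linarith)
  have hd2 : ∀ x : ℝ, 0 ≤ x → 1 ≤ (((X + C 6) ^ 3 * (X + C 14)) ^ 2 : ℝ[X]).eval x :=
    fun x hx => by
      rw [eval_pow]
      exact one_le_pow₀ (hd x hx)
  rw [setIntegral_congr_fun measurableSet_Ioi fun x hx => weight_mul_LagE_mul_LagE n m hx,
    integral_add ((integrableOn_exp_neg_mul_eval _).const_mul _)
      (integrableOn_exp_neg_mul_eval_div _ _ hd2),
    integral_deriv_exp_neg_mul_eval_div _ _ (by simp [boundaryNumerator]) hd, add_zero,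
    integral_const_mul]
  split_ifs with h
  · subst h
    rw [integral_lagPoly_sq]
    ring
  · rw [integral_lagPoly_mul_of_ne h, mul_zero]
end

section
/- Define on (0,∞) the prepotential w_A(x) := −x²/2 + (3/4)·log x + log(15 + 4x²) − 2·log(3 + 4x²) and the potential U_A(x) := x² − 3/(16x²) + 48/(3+4x²) − 288/(3+4x²)² − 13/2. Then for every x > 0, (w_A'(x))² + w_A''(x) − 8 = U_A(x). Consequently the function φᴬ_{−2}(x) := e^{w_A(x)} = e^{−x²/2} x^{3/4} (15+4x²)/(3+4x²)² satisfies the Schrödinger equation −φᴬ_{−2}''(x) + U_A(x) φᴬ_{−2}(x) = −8 φᴬ_{−2}(x) on (0,∞). -/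
/-- The prepotential `w_A(x) = −x²/2 + (3/4) log x + log(15+4x²) − 2 log(3+4x²)`. -/
noncomputable def wA (x : ℝ) : ℝ :=
  -x^2/2 + (3/4) * Real.log x + Real.log (15 + 4*x^2) - 2 * Real.log (3 + 4*x^2)

/-- The potential `U_A(x)` of case (A). -/
noncomputable def UA (x : ℝ) : ℝ :=
  x^2 - 3/(16*x^2) + 48/(3+4*x^2) - 288/(3+4*x^2)^2 - 13/2

/-- The derivative of `wA` on `(0,∞)`. -/
lemma hasDerivAt_wA {x : ℝ} (hx : 0 < x) :
    HasDerivAt wA (-x + 3 / (4 * x) + 8 * x / (15 + 4 * x ^ 2) - 16 * x / (3 + 4 * x ^ 2)) x := by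
  have hsq : HasDerivAt (fun y : ℝ => y ^ 2) (2 * x) x := by simpa using hasDerivAt_pow 2 x
  have h15 : HasDerivAt (fun y : ℝ => 15 + 4 * y ^ 2) (4 * (2 * x)) x :=
    (hsq.const_mul 4).const_add 15
  have h3 : HasDerivAt (fun y : ℝ => 3 + 4 * y ^ 2) (4 * (2 * x)) x :=
    (hsq.const_mul 4).const_add 3
  have p15 : (15 + 4 * x ^ 2 : ℝ) ≠ 0 := by positivity
  have p3 : (3 + 4 * x ^ 2 : ℝ) ≠ 0 := by positivity
  refine ((((hsq.neg.div_const 2).add ((Real.hasDerivAt_log hx.ne').const_mul (3 / 4))).add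
    (h15.log p15)).sub ((h3.log p3).const_mul 2)).congr_deriv ?_
  field_simp
  ring

/-- The second derivative of `wA` on `(0,∞)`. -/
lemma hasDerivAt_deriv_wA {x : ℝ} (hx : 0 < x) :
    HasDerivAt (deriv wA) (-1 - 3 / (4 * x ^ 2) + 8 * (15 - 4 * x ^ 2) / (15 + 4 * x ^ 2) ^ 2
      - 16 * (3 - 4 * x ^ 2) / (3 + 4 * x ^ 2) ^ 2) x := by
  have hsq : HasDerivAt (fun y : ℝ => y ^ 2) (2 * x) x := by simpa using hasDerivAt_pow 2 x
  have h15 : HasDerivAt (fun y : ℝ => 15 + 4 * y ^ 2) (4 * (2 * x)) x :=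
    (hsq.const_mul 4).const_add 15
  have h3 : HasDerivAt (fun y : ℝ => 3 + 4 * y ^ 2) (4 * (2 * x)) x :=
    (hsq.const_mul 4).const_add 3
  have p15 : (15 + 4 * x ^ 2 : ℝ) ≠ 0 := by positivity
  have p3 : (3 + 4 * x ^ 2 : ℝ) ≠ 0 := by positivity
  have hid := hasDerivAt_id' x
  have heq : deriv wA =ᶠ[nhds x] fun y =>
      -y + 3 / (4 * y) + 8 * y / (15 + 4 * y ^ 2) - 16 * y / (3 + 4 * y ^ 2) := by
    filter_upwards [lt_mem_nhds hx] with y hy using (hasDerivAt_wA hy).deriv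
  refine HasDerivAt.congr_of_eventuallyEq ?_ heq
  refine (((hid.neg.add ((hasDerivAt_const x (3 : ℝ)).div (hid.const_mul 4) (by positivity))).add
    ((hid.const_mul 8).div h15 p15)).sub ((hid.const_mul 16).div h3 p3)).congr_deriv ?_
  field_simp
  ring

/-- The Riccati equation for the prepotential `wA`. -/
lemma riccati_wA {x : ℝ} (hx : 0 < x) : (deriv wA x) ^ 2 + deriv (deriv wA) x - 8 = UA x := by
  rw [(hasDerivAt_deriv_wA hx).deriv, (hasDerivAt_wA hx).deriv, UA]
  have p15 : (15 + 4 * x ^ 2 : ℝ) ≠ 0 := by positivity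
  have p3 : (3 + 4 * x ^ 2 : ℝ) ≠ 0 := by positivity
  field_simp
  ring

/-- the prepotential `w_A` satisfies the Riccati equation
`(w_A')² + w_A'' − 8 = U_A`, and consequently `φᴬ_{−2} = e^{w_A}`, which equals
`e^{−x²/2} x^{3/4} (15+4x²)/(3+4x²)²`, satisfies the Schrödinger equation
`−φ'' + U_A φ = −8 φ` on `(0,∞)`. -/
theorem prepotential_A :
    (∀ x : ℝ, 0 < x → (deriv wA x)^2 + deriv (deriv wA) x - 8 = UA x) ∧
    (∀ x : ℝ, 0 < x →
      Real.exp (wA x) = Real.exp (-x^2/2) * x ^ ((3:ℝ)/4) * (15 + 4*x^2) / (3 + 4*x^2)^2) ∧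
    (∀ x : ℝ, 0 < x →
      -deriv (deriv (fun y => Real.exp (wA y))) x + UA x * Real.exp (wA x)
        = -8 * Real.exp (wA x)) := by
  refine ⟨fun x hx => riccati_wA hx, fun x hx => ?_, fun x hx => ?_⟩
  · have p15 : (0 : ℝ) < 15 + 4 * x ^ 2 := by positivity
    have p3 : (0 : ℝ) < 3 + 4 * x ^ 2 := by positivity
    rw [wA, Real.exp_sub, Real.exp_add, Real.exp_add, Real.exp_log p15,
      Real.rpow_def_of_pos hx, mul_comm (3 / 4) (Real.log x), two_mul (Real.log _),
      Real.exp_add (Real.log _), Real.exp_log p3, ← sq]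
  · have heq : deriv (fun y => Real.exp (wA y)) =ᶠ[nhds x]
        fun y => Real.exp (wA y) * deriv wA y := by
      filter_upwards [lt_mem_nhds hx] with y hy
      exact (hasDerivAt_wA hy).differentiableAt.hasDerivAt.exp.deriv
    have hw := (hasDerivAt_wA hx).differentiableAt.hasDerivAt
    have hw' := (hasDerivAt_deriv_wA hx).differentiableAt.hasDerivAt
    rw [heq.deriv_eq, (hw.exp.fun_mul hw').deriv, ← riccati_wA hx]
    ring
end
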